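/- Let α > 0, let γ satisfy 0 < γ < min(1, α), let u_0 ∈ ℝ, and let f : {p^k : k ∈ ℤ} × ℝ → ℝ satisfy |f(p^ℓ, x)| ≤ M for all ℓ ∈ ℤ and x ∈ ℝ, |f(r, x) − f(r, y)| ≤ F |x − y| for all r and x, y, and additionally |f(p^ℓ, x) − f(p^ℓ, y)| ≤ F_ℓ |x − y| for all x, y ∈ ℝ with constants satisfying 0 < F_ℓ < p^{−αℓ} for every ℓ ∈ ℤ. Then there exists a radial function u defined on all of ℚ_p with u(0) = u_0 such that u(|t|_p) = u_0 + (I^α [ f̃(|·|_p, u(|·|_p)) ])(|t|_p) for every nonzero t ∈ ℚ_p; that is, the local mild solution of the degenerate Cauchy problem extends to a global mild solution defined for all t ∈ ℚ_p. -/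

import Mathlib

open MeasureTheory Metric

noncomputable section

variable (p : ℕ) [Fact p.Prime]

instance : MeasurableSpace ℚ_[p] := borel _
instance : BorelSpace ℚ_[p] := ⟨rfl⟩

/-- The closed unit ball of `ℚ_[p]` as a positive compact set. -/
def unitBallPC : TopologicalSpace.PositiveCompacts ℚ_[p] where
  carrier := closedBall 0 1
  isCompact' := isCompact_closedBall 0 1
  interior_nonempty' := ⟨0, mem_interior_iff_mem_nhds.2
    (Filter.mem_of_superset (ball_mem_nhds 0 one_pos) ball_subset_closedBall)⟩

/-- The Haar measure on `ℚ_[p]` normalized so the unit ball has measure 1. -/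
def padicHaar : Measure ℚ_[p] := Measure.addHaarMeasure (unitBallPC p)

/-- A point on the sphere of radius `p^k`. -/
def sph (k : ℤ) : ℚ_[p] := (p : ℚ_[p]) ^ (-k)

/-- A function is radial if it depends only on the p-adic absolute value. -/
def Radial (u : ℚ_[p] → ℝ) : Prop := ∀ x y : ℚ_[p], ‖x‖ = ‖y‖ → u x = u y

/-- The integrand of the Vladimirov operator `D^α` at `x`. -/
def Dker (α : ℝ) (u : ℚ_[p] → ℝ) (x : ℚ_[p]) : ℚ_[p] → ℝ :=
  fun y => ‖y‖ ^ (-α - 1) * (u (x - y) - u x)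

/-- The Vladimirov fractional differentiation operator. -/
def Dop (α : ℝ) (u : ℚ_[p] → ℝ) (x : ℚ_[p]) : ℝ :=
  ((1 - (p : ℝ) ^ α) / (1 - (p : ℝ) ^ (-α - 1))) * ∫ y, Dker p α u x y ∂(padicHaar p)

/-- The kernel of the fractional integral `I^α`. -/
def Iker (α : ℝ) (x y : ℚ_[p]) : ℝ :=
  if α = 1 then Real.log ‖x - y‖ - Real.log ‖y‖
  else ‖x - y‖ ^ (α - 1) - ‖y‖ ^ (α - 1)

/-- The constant in front of the fractional integral. -/
def Icoef (α : ℝ) : ℝ :=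
  if α = 1 then (1 - (p : ℝ)) / (p * Real.log p)
  else (1 - (p : ℝ) ^ (-α)) / (1 - (p : ℝ) ^ (α - 1))

/-- The p-adic fractional integral `I^α`. -/
def Iop (α : ℝ) (u : ℚ_[p] → ℝ) (x : ℚ_[p]) : ℝ :=
  Icoef p α * ∫ y in {y : ℚ_[p] | ‖y‖ ≤ ‖x‖}, Iker p α x y * u y ∂(padicHaar p)

end

section Aux

variable (p : ℕ) [Fact p.Prime]

instance padicHaar_isAddHaar : (padicHaar p).IsAddHaarMeasure := by
  unfold padicHaar; infer_instance

lemma one_lt_p : (1 : ℝ) < p := by exact_mod_cast (Fact.out : p.Prime).one_lt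

lemma ball_step (t : ℚ_[p]) (ht : t ≠ 0) :
    (p : ℝ) * (padicHaar p).real (closedBall 0 (‖t‖ / p)) ≤ (padicHaar p).real (closedBall 0 ‖t‖) := by
  have hp := one_lt_p p
  have htpos : 0 < ‖t‖ := norm_pos_iff.2 ht
  have hlt : ‖t‖ / p < ‖t‖ := div_lt_self htpos hp
  have hdis : Pairwise (Function.onFun Disjoint
      (fun i : Fin p => closedBall ((i : ℕ) * t : ℚ_[p]) (‖t‖ / p))) := by
    intro i j hij
    rw [Function.onFun, Set.disjoint_left]
    intro y hy hy'
    rw [mem_closedBall] at hy hy'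
    have h1 : dist ((i : ℕ) * t : ℚ_[p]) ((j : ℕ) * t) ≤ ‖t‖ / p := by
      refine (dist_triangle_max _ y _).trans (max_le ?_ hy')
      rwa [dist_comm]
    rw [dist_eq_norm, ← sub_mul, norm_mul] at h1
    have h2 : ‖(((i : ℕ) : ℚ_[p]) - ((j : ℕ) : ℚ_[p]))‖ = 1 := by
      have h3 : ‖(((((i : ℕ) : ℤ) - ((j : ℕ) : ℤ) : ℤ)) : ℚ_[p])‖ = 1 := by
        refine le_antisymm (Padic.norm_int_le_one _) ?_
        by_contra hcon
        rw [not_le, Padic.norm_intCast_lt_one_iff] at hcon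
        obtain ⟨c, hc⟩ := hcon
        have hi := i.2
        have hj := j.2
        have : c = 0 := by
          by_contra hc0
          rcases lt_or_gt_of_ne hc0 with h | h
          · have : (p : ℤ) * c ≤ (p : ℤ) * (-1) := by
              apply mul_le_mul_of_nonneg_left <;> omega
            omega
          · have : (p : ℤ) * 1 ≤ (p : ℤ) * c := by
              apply mul_le_mul_of_nonneg_left <;> omega
            omega
        apply hij
        ext
        rw [this] at hc
        omega
      push_cast at h3
      exact h3
    rw [h2, one_mul] at h1
    linarith
  have hsub : (⋃ i : Fin p, closedBall ((i : ℕ) * t : ℚ_[p]) (‖t‖ / p)) ⊆ closedBall 0 ‖t‖ := by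
    intro y hy
    obtain ⟨i, hi⟩ := Set.mem_iUnion.1 hy
    rw [mem_closedBall] at hi ⊢
    refine (dist_triangle_max _ ((i : ℕ) * t : ℚ_[p]) _).trans (max_le (hi.trans hlt.le) ?_)
    rw [dist_zero_right, norm_mul]
    have : ‖((i : ℕ) : ℚ_[p])‖ ≤ 1 := by exact_mod_cast Padic.norm_int_le_one (p := p) (i : ℕ)
    nlinarith
  have h1 := measureReal_mono (μ := padicHaar p) hsub
    (isCompact_closedBall _ _).measure_lt_top.ne
  rw [measureReal_iUnion_fintype hdis (fun i => isClosed_closedBall.measurableSet)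
    (fun i => (isCompact_closedBall _ _).measure_lt_top.ne)] at h1
  have h2 : ∀ a : ℚ_[p], (padicHaar p).real (closedBall a (‖t‖ / p))
      = (padicHaar p).real (closedBall 0 (‖t‖ / p)) := by
    intro a
    simp only [measureReal_def]
    rw [Measure.addHaar_closedBall_center]
  simp only [h2] at h1
  simpa using h1

lemma ball_bound (t : ℚ_[p]) (ht : t ≠ 0) (m : ℕ) :
    (padicHaar p).real (closedBall 0 (‖t‖ / (p : ℝ) ^ m)) ≤
      (padicHaar p).real (closedBall 0 ‖t‖) / (p : ℝ) ^ m := by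
  have hp := one_lt_p p
  have hp0 : (p : ℚ_[p]) ≠ 0 := by exact_mod_cast (Fact.out : p.Prime).ne_zero
  induction m with
  | zero => simp
  | succ m ih =>
    have h := ball_step p (t * (p : ℚ_[p]) ^ m) (mul_ne_zero ht (pow_ne_zero _ hp0))
    have e : ‖t * (p : ℚ_[p]) ^ m‖ = ‖t‖ / (p : ℝ) ^ m := by
      rw [norm_mul, norm_pow, Padic.norm_p, inv_pow]; rfl
    rw [e, div_div, ← pow_succ] at h
    have h' := h.trans ih
    rw [← le_div_iff₀' (by positivity), div_div, ← pow_succ] at h'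
    exact h'

lemma integrable_rpow (t : ℚ_[p]) (ht : t ≠ 0) (β : ℝ) (hβ : β < 1) :
    IntegrableOn (fun y : ℚ_[p] => ‖y‖ ^ (-β)) {y | ‖y‖ ≤ ‖t‖} (padicHaar p) := by
  have hp := one_lt_p p
  have hp0 : (0 : ℝ) < p := by linarith
  have htpos : 0 < ‖t‖ := norm_pos_iff.2 ht
  set S : ℕ → Set ℚ_[p] := fun m => sphere 0 (‖t‖ / (p : ℝ) ^ m) with hS
  have hsub : {y : ℚ_[p] | ‖y‖ ≤ ‖t‖} ⊆ {0} ∪ ⋃ m, S m := by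
    intro y hy
    by_cases hy0 : y = 0
    · left; exact hy0
    right
    rw [Set.mem_ofPred_eq, Padic.norm_eq_zpow_neg_valuation hy0, Padic.norm_eq_zpow_neg_valuation ht,
      zpow_le_zpow_iff_right₀ hp] at hy
    rw [Set.mem_iUnion]
    refine ⟨(y.valuation - t.valuation).toNat, ?_⟩
    rw [hS, mem_sphere, dist_zero_right, Padic.norm_eq_zpow_neg_valuation hy0,
      Padic.norm_eq_zpow_neg_valuation ht, ← zpow_natCast, ← zpow_sub₀ hp0.ne']
    congr 1
    omega
  have hSm : ∀ m, MeasurableSet (S m) := fun m => isClosed_sphere.measurableSet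
  have hSf : ∀ m, padicHaar p (S m) < ⊤ := fun m => (isCompact_sphere _ _).measure_lt_top
  refine IntegrableOn.mono_set ?_ hsub
  refine IntegrableOn.union ?_ ?_
  · exact integrableOn_singleton (by simp) (isCompact_singleton.measure_lt_top)
  have hval : ∀ m, ∀ y ∈ S m, ‖y‖ ^ (-β) = ‖t‖ ^ (-β) * ((p : ℝ) ^ β) ^ m := by
    intro m y hy
    rw [hS, mem_sphere, dist_zero_right] at hy
    rw [hy, Real.div_rpow htpos.le (by positivity), div_eq_mul_inv]
    congr 1
    rw [← Real.rpow_neg (by positivity), neg_neg, ← Real.rpow_natCast, ← Real.rpow_natCast,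
      ← Real.rpow_mul hp0.le, ← Real.rpow_mul hp0.le, mul_comm]
  refine integrableOn_iUnion_of_summable_integral_norm ?_ ?_
  · intro m
    exact (integrableOn_const (C := ‖t‖ ^ (-β) * ((p : ℝ) ^ β) ^ m) (hSf m).ne).congr_fun
      (fun y hy => (hval m y hy).symm) (hSm m)
  · have hq : (p : ℝ) ^ β / p < 1 := by
      rw [div_lt_one hp0]
      simpa using Real.rpow_lt_rpow_of_exponent_lt hp hβ
    refine Summable.of_nonneg_of_le (fun m => integral_nonneg fun _ => norm_nonneg _) ?_
      ((summable_geometric_of_lt_one (by positivity) hq).mul_left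
        (‖t‖ ^ (-β) * (padicHaar p).real (closedBall 0 ‖t‖)))
    intro m
    have e : ∫ y in S m, ‖‖y‖ ^ (-β)‖ ∂(padicHaar p)
        = (padicHaar p).real (S m) * (‖t‖ ^ (-β) * ((p : ℝ) ^ β) ^ m) := by
      rw [setIntegral_congr_fun (g := fun _ => ‖t‖ ^ (-β) * ((p : ℝ) ^ β) ^ m) (hSm m)]
      · simp
      · intro y hy
        simp only
        rw [Real.norm_of_nonneg (by positivity), hval m y hy]
    rw [e]
    have h1 : (padicHaar p).real (S m) ≤ (padicHaar p).real (closedBall 0 ‖t‖) / (p : ℝ) ^ m :=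
      (measureReal_mono sphere_subset_closedBall
        (isCompact_closedBall _ _).measure_lt_top.ne).trans (ball_bound p t ht m)
    calc _ ≤ (padicHaar p).real (closedBall 0 ‖t‖) / (p : ℝ) ^ m *
          (‖t‖ ^ (-β) * ((p : ℝ) ^ β) ^ m) := by gcongr
      _ = _ := by rw [div_pow]; ring

/-- The radial profile of the kernel of `I^α`. -/
noncomputable def gk (α r : ℝ) : ℝ := if α = 1 then Real.log r else r ^ (α - 1)

lemma Iker_eq (α : ℝ) (x y : ℚ_[p]) : Iker p α x y = gk α ‖x - y‖ - gk α ‖y‖ := by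
  unfold Iker gk; split_ifs <;> rfl

lemma gk_zero (α : ℝ) : gk α 0 = 0 := by
  unfold gk
  split_ifs with h
  · simp
  · exact Real.zero_rpow (sub_ne_zero.2 h)

lemma measurable_gk (α : ℝ) : Measurable (gk α) := by
  unfold gk
  split_ifs with h
  · exact Real.measurable_log
  · fun_prop

lemma gk_bound (α δ R : ℝ) (hδ1 : δ < 1) (hδα : δ < α) :
    ∃ C β : ℝ, 0 ≤ C ∧ β + δ < 1 ∧ ∀ r, 0 < r → r ≤ R → |gk α r| ≤ C * r ^ (-β) := by
  unfold gk
  split_ifs with h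
  · set ε := (1 - δ) / 2 with hε
    have hε0 : 0 < ε := by rw [hε]; linarith
    refine ⟨1 / ε + |Real.log R| * R ^ ε ⊔ 0, ε, by positivity, by rw [hε]; linarith, ?_⟩
    intro r hr hrR
    have hR : 0 < R := hr.trans_le hrR
    rw [max_eq_left (by positivity), Real.rpow_neg hr.le, ← div_eq_mul_inv,
      le_div_iff₀ (by positivity)]
    rcases le_total r 1 with h1 | h1
    · have := Real.abs_log_mul_self_rpow_lt r ε hr h1 hε0
      rw [abs_mul, abs_of_pos (Real.rpow_pos_of_pos hr ε)] at this
      have : 0 ≤ |Real.log R| * R ^ ε := by positivity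
      linarith
    · have h2 : |Real.log r| ≤ |Real.log R| := by
        rw [abs_of_nonneg (Real.log_nonneg h1), abs_of_nonneg (Real.log_nonneg (h1.trans hrR))]
        exact Real.log_le_log hr hrR
      have h3 : r ^ ε ≤ R ^ ε := Real.rpow_le_rpow hr.le hrR hε0.le
      have h4 : |Real.log r| * r ^ ε ≤ |Real.log R| * R ^ ε := by gcongr
      have : 0 < 1 / ε := by positivity
      linarith
  · refine ⟨1, 1 - α, zero_le_one, by linarith, ?_⟩
    intro r hr _
    rw [one_mul, abs_of_pos (Real.rpow_pos_of_pos hr _), neg_sub]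

lemma measurableSet_nball (t : ℚ_[p]) : MeasurableSet {y : ℚ_[p] | ‖y‖ ≤ ‖t‖} :=
  measurableSet_le measurable_norm measurable_const

lemma integrable_gk (α δ : ℝ) (hδ1 : δ < 1) (hδα : δ < α) (t : ℚ_[p]) (ht : t ≠ 0) :
    IntegrableOn (fun y : ℚ_[p] => |gk α ‖y‖| * ‖y‖ ^ (-δ)) {y | ‖y‖ ≤ ‖t‖} (padicHaar p) := by
  obtain ⟨C, β, hC, hβ, hb⟩ := gk_bound α δ ‖t‖ hδ1 hδα
  refine Integrable.mono' ((integrable_rpow p t ht (β + δ) hβ).const_mul C) ?_ ?_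
  · have := (measurable_gk α).comp (measurable_norm (α := ℚ_[p]))
    have h2 : Measurable fun y : ℚ_[p] => |gk α ‖y‖| * ‖y‖ ^ (-δ) := by
      refine Measurable.mul ?_ ?_
      · exact this.abs
      · exact measurable_norm.pow_const _
    exact h2.aestronglyMeasurable
  · refine (ae_restrict_iff' (measurableSet_nball p t)).2 (Filter.Eventually.of_forall ?_)
    intro y hy
    rcases eq_or_ne y 0 with rfl | hy0
    · simp only [norm_zero, gk_zero, abs_zero, zero_mul]
      positivity
    have hpos : 0 < ‖y‖ := norm_pos_iff.2 hy0
    rw [Real.norm_of_nonneg (by positivity), neg_add, Real.rpow_add hpos, ← mul_assoc]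
    gcongr
    exact hb _ hpos hy

lemma measurable_Iker (α : ℝ) (t : ℚ_[p]) : Measurable (Iker p α t) := by
  have h : Iker p α t = fun y => gk α ‖t - y‖ - gk α ‖y‖ := funext (Iker_eq p α t)
  rw [h]
  exact ((measurable_gk α).comp (measurable_const.sub measurable_id).norm).sub
    ((measurable_gk α).comp measurable_norm)

lemma integrable_Iker (α γ : ℝ) (hα : 0 < α) (hγ1 : γ < 1) (hγα : γ < α)
    (t : ℚ_[p]) (ht : t ≠ 0) :
    IntegrableOn (fun y : ℚ_[p] => |Iker p α t y| * ‖y‖ ^ (-γ)) {y | ‖y‖ ≤ ‖t‖}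
      (padicHaar p) := by
  have i1 := integrable_gk p α γ hγ1 hγα t ht
  have i2 := (integrable_rpow p t ht γ hγ1).const_mul |gk α ‖t‖|
  have i3 : IntegrableOn (fun y : ℚ_[p] => |gk α ‖t - y‖|) {y | ‖y‖ ≤ ‖t‖} (padicHaar p) := by
    have h := integrable_gk p α 0 one_pos hα t ht
    simp only [neg_zero, Real.rpow_zero, mul_one] at h
    rw [← integrable_indicator_iff (measurableSet_nball p t)] at h ⊢
    have h' := h.comp_sub_left t
    refine h'.congr (Filter.Eventually.of_forall fun y => ?_)
    have hiff : ‖t - y‖ ≤ ‖t‖ ↔ ‖y‖ ≤ ‖t‖ := by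
      constructor
      · intro h
        have := Padic.nonarchimedean t (-(t - y))
        rw [norm_neg] at this
        simpa using this.trans (max_le le_rfl h)
      · intro h
        have := Padic.nonarchimedean t (-y)
        rw [norm_neg, ← sub_eq_add_neg] at this
        exact this.trans (max_le le_rfl h)
    simp only [Set.indicator, Set.mem_ofPred_eq, hiff]
  have i4 := i3.const_mul (‖t‖ ^ (-γ))
  refine Integrable.mono' ((i2.add i4).add i1) ?_ ?_
  · exact ((measurable_Iker p α t).abs.mul (measurable_norm.pow_const _)).aestronglyMeasurable
  · refine (ae_restrict_iff' (measurableSet_nball p t)).2 (Filter.Eventually.of_forall ?_)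
    intro y hy
    simp only [Pi.add_apply]
    rw [Real.norm_of_nonneg (by positivity), Iker_eq]
    have hg : 0 ≤ ‖y‖ ^ (-γ) := by positivity
    have h1 : |gk α ‖t - y‖| * ‖y‖ ^ (-γ) ≤
        |gk α ‖t‖| * ‖y‖ ^ (-γ) + ‖t‖ ^ (-γ) * |gk α ‖t - y‖| := by
      rcases eq_or_ne ‖y‖ ‖t‖ with h | h
      · rw [h]
        have : 0 ≤ |gk α ‖t‖| * ‖t‖ ^ (-γ) := by positivity
        linarith
      · have h2 : ‖t - y‖ = ‖t‖ := by
          have h3 : ‖t‖ ≠ ‖-y‖ := by rw [norm_neg]; exact h.symm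
          rw [sub_eq_add_neg, Padic.add_eq_max_of_ne h3, norm_neg]
          exact max_eq_left hy
        rw [h2]
        have : 0 ≤ ‖t‖ ^ (-γ) * |gk α ‖t‖| := by positivity
        linarith
    have h2 := mul_le_mul_of_nonneg_right (abs_sub (gk α ‖t - y‖) (gk α ‖y‖)) hg
    rw [add_mul] at h2
    linarith

/-- Multiplication by a unit preserves the Haar measure. -/
lemma mp_unit (c : ℚ_[p]) (hc : ‖c‖ = 1) :
    MeasurePreserving (fun y => c * y) (padicHaar p) (padicHaar p) := by
  have hc0 : c ≠ 0 := by
    rintro rfl; simp at hc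
  refine ⟨(continuous_const_mul c).measurable, ?_⟩
  let e : ℚ_[p] ≃+ ℚ_[p] := { Equiv.mulLeft₀ c hc0 with map_add' := mul_add c }
  have hh : ((padicHaar p).map e).IsAddHaarMeasure :=
    AddEquiv.isAddHaarMeasure_map _ _ (by exact continuous_const_mul c)
      (by exact continuous_const_mul c⁻¹)
  have hmap : (padicHaar p).map (fun y => c * y) = (padicHaar p).map e := rfl
  rw [hmap]
  have h := Measure.addHaarMeasure_unique ((padicHaar p).map e) (unitBallPC p)
  rw [h]
  have h1 : (padicHaar p).map e (unitBallPC p) = 1 := by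
    rw [← hmap, Measure.map_apply (continuous_const_mul c).measurable
      (unitBallPC p).isCompact.measurableSet]
    have : (fun y => c * y) ⁻¹' (unitBallPC p : Set ℚ_[p]) = (unitBallPC p : Set ℚ_[p]) := by
      ext y
      change c * y ∈ closedBall 0 1 ↔ y ∈ closedBall 0 1
      simp [hc]
    rw [this]
    exact Measure.addHaarMeasure_self
  rw [h1, one_smul]
  rfl

lemma Iop_radial (α : ℝ) (v : ℚ_[p] → ℝ) (hv : Radial p v) (s t : ℚ_[p]) (ht : t ≠ 0)
    (hst : ‖s‖ = ‖t‖) : Iop p α v s = Iop p α v t := by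
  have htpos : 0 < ‖t‖ := norm_pos_iff.2 ht
  set c := s / t with hcdef
  have hc : ‖c‖ = 1 := by rw [hcdef, norm_div, hst, div_self htpos.ne']
  have hs : s = c * t := by rw [hcdef, div_mul_cancel₀ _ ht]
  have hc0 : c ≠ 0 := by
    rintro h; rw [h] at hc; simp at hc
  unfold Iop
  congr 1
  rw [← (mp_unit p c hc).setIntegral_preimage_emb
    (Homeomorph.mulLeft₀ c hc0).measurableEmbedding]
  have hpre : (fun y => c * y) ⁻¹' {y : ℚ_[p] | ‖y‖ ≤ ‖s‖} = {y | ‖y‖ ≤ ‖t‖} := by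
    ext y
    simp [hc, hst]
  rw [hpre]
  congr 1
  funext y
  rw [Iker_eq, Iker_eq, hs, ← mul_sub, norm_mul, norm_mul, hc, one_mul, one_mul,
    hv (c * y) y (by rw [norm_mul, hc, one_mul])]

lemma measurable_val : Measurable (fun y : ℚ_[p] => y.valuation) := by
  have hp := one_lt_p p
  refine measurable_to_countable' fun k => ?_
  have h : (fun y : ℚ_[p] => y.valuation) ⁻¹' {k} =
      sphere 0 ((p : ℝ) ^ (-k)) ∪ ({0} ∩ {_y : ℚ_[p] | k = 0}) := by
    ext y
    rcases eq_or_ne y 0 with rfl | hy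
    · have : (p : ℝ) ^ k ≠ 0 := (zpow_pos (by linarith) _).ne'
      simp [eq_comm, this]
    · simp only [Set.mem_preimage, Set.mem_singleton_iff, Set.mem_union, mem_sphere,
        dist_zero_right, Set.mem_inter_iff, hy, false_and, or_false]
      rw [Padic.norm_eq_zpow_neg_valuation hy, zpow_right_inj₀ (by linarith) hp.ne']
      simp
  rw [h]
  exact isClosed_sphere.measurableSet.union ((measurableSet_singleton _).inter (.const _))

lemma norm_sph (k : ℤ) : ‖sph p k‖ = (p : ℝ) ^ k := by
  unfold sph
  rw [norm_zpow, Padic.norm_p, inv_zpow, zpow_neg, inv_inv]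

lemma sph_ne_zero (k : ℤ) : sph p k ≠ 0 := by
  have hp := one_lt_p p
  rw [← norm_pos_iff, norm_sph]
  exact zpow_pos (by linarith) _

/-- The right-hand side associated with the sequence `w`. -/
noncomputable def Vf (γ : ℝ) (f : ℤ → ℝ → ℝ) (w : ℤ → ℝ) (y : ℚ_[p]) : ℝ :=
  ‖y‖ ^ (-γ) * f (-y.valuation) (w (-y.valuation))

lemma measurable_Vf (γ : ℝ) (f : ℤ → ℝ → ℝ) (w : ℤ → ℝ) : Measurable (Vf p γ f w) := by
  unfold Vf
  refine (measurable_norm.pow_const _).mul ?_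
  exact (measurable_from_top (f := fun k : ℤ => f (-k) (w (-k)))).comp (measurable_val p)

lemma radial_Vf (γ : ℝ) (hγ : 0 < γ) (f : ℤ → ℝ → ℝ) (w : ℤ → ℝ) : Radial p (Vf p γ f w) := by
  intro x y hxy
  have hp := one_lt_p p
  rcases eq_or_ne x 0 with rfl | hx
  · have : y = 0 := by
      rw [← norm_eq_zero, ← hxy, norm_zero]
    rw [this]
  · have hy : y ≠ 0 := by
      rw [← norm_pos_iff, ← hxy]; exact norm_pos_iff.2 hx
    have hv : x.valuation = y.valuation := by
      have h := hxy
      rw [Padic.norm_eq_zpow_neg_valuation hx, Padic.norm_eq_zpow_neg_valuation hy,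
        zpow_right_inj₀ (by linarith) hp.ne'] at h
      exact neg_injective h
    unfold Vf
    rw [hxy, hv]

lemma Vf_bound (α γ M : ℝ) (f : ℤ → ℝ → ℝ) (hM : ∀ (ℓ : ℤ) (x : ℝ), |f ℓ x| ≤ M) (w : ℤ → ℝ)
    (t y : ℚ_[p]) : ‖Iker p α t y * Vf p γ f w y‖ ≤ |Iker p α t y| * ‖y‖ ^ (-γ) * M := by
  have h0 : 0 ≤ ‖y‖ ^ (-γ) := by positivity
  unfold Vf
  rw [Real.norm_eq_abs, abs_mul, abs_mul, abs_of_nonneg h0, ← mul_assoc]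
  gcongr
  exact hM _ _

lemma integrable_Vf (α γ M : ℝ) (hα : 0 < α) (hγ1 : γ < 1) (hγα : γ < α)
    (f : ℤ → ℝ → ℝ) (hM : ∀ (ℓ : ℤ) (x : ℝ), |f ℓ x| ≤ M) (w : ℤ → ℝ)
    (t : ℚ_[p]) (ht : t ≠ 0) :
    IntegrableOn (fun y => Iker p α t y * Vf p γ f w y) {y : ℚ_[p] | ‖y‖ ≤ ‖t‖} (padicHaar p) :=
  Integrable.mono' ((integrable_Iker p α γ hα hγ1 hγα t ht).mul_const M)
    ((measurable_Iker p α t).mul (measurable_Vf p γ f w)).aestronglyMeasurable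
    (Filter.Eventually.of_forall fun y => Vf_bound p α γ M f hM w t y)

lemma continuous_Iop (α γ M : ℝ) (hα : 0 < α) (hγ1 : γ < 1) (hγα : γ < α)
    (f : ℤ → ℝ → ℝ) (hM : ∀ (ℓ : ℤ) (x : ℝ), |f ℓ x| ≤ M) (hfc : ∀ ℓ, Continuous (f ℓ))
    (t : ℚ_[p]) (ht : t ≠ 0) :
    Continuous (fun w : ℤ → ℝ => Iop p α (Vf p γ f w) t) := by
  unfold Iop
  refine continuous_const.mul ?_
  refine continuous_of_dominated
    (fun w => ((measurable_Iker p α t).mul (measurable_Vf p γ f w)).aestronglyMeasurable)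
    (fun w => Filter.Eventually.of_forall fun y => Vf_bound p α γ M f hM w t y)
    ((integrable_Iker p α γ hα hγ1 hγα t ht).mul_const M)
    (Filter.Eventually.of_forall fun y => ?_)
  unfold Vf
  exact continuous_const.mul (continuous_const.mul ((hfc _).comp (continuous_apply _)))

lemma Iop_bound (α γ M : ℝ) (hα : 0 < α) (hγ1 : γ < 1) (hγα : γ < α)
    (f : ℤ → ℝ → ℝ) (hM : ∀ (ℓ : ℤ) (x : ℝ), |f ℓ x| ≤ M) (t : ℚ_[p]) (ht : t ≠ 0) :
    ∃ C : ℝ, ∀ w : ℤ → ℝ, |Iop p α (Vf p γ f w) t| ≤ C := by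
  refine ⟨|Icoef p α| * ∫ y in {y : ℚ_[p] | ‖y‖ ≤ ‖t‖},
    |Iker p α t y| * ‖y‖ ^ (-γ) * M ∂(padicHaar p), fun w => ?_⟩
  unfold Iop
  rw [abs_mul]
  gcongr
  exact norm_integral_le_of_norm_le ((integrable_Iker p α γ hα hγ1 hγα t ht).mul_const M)
    (Filter.Eventually.of_forall fun y => Vf_bound p α γ M f hM w t y)

lemma Iop_congr (α γ : ℝ) (hγ : 0 < γ) (f : ℤ → ℝ → ℝ) (n : ℤ) (w w' : ℤ → ℝ)
    (h : ∀ k ≤ n, w k = w' k) :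
    Iop p α (Vf p γ f w) (sph p n) = Iop p α (Vf p γ f w') (sph p n) := by
  unfold Iop
  congr 1
  refine setIntegral_congr_fun (measurableSet_nball p _) fun y hy => ?_
  have hp := one_lt_p p
  simp only [Vf]
  rcases eq_or_ne y 0 with rfl | hy0
  · rw [norm_zero, Real.zero_rpow (by linarith)]; simp
  · rw [Set.mem_ofPred_eq, norm_sph, Padic.norm_eq_zpow_neg_valuation hy0,
      zpow_le_zpow_iff_right₀ hp] at hy
    rw [h _ hy]

/-- Abstract solvability: a triangular system of bounded continuous equations indexed by `ℤ`. -/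
lemma exists_sequence (u₀ : ℝ) (P : ℤ → (ℤ → ℝ) → ℝ) (hc : ∀ n, Continuous (P n))
    (C : ℤ → ℝ) (hC : ∀ n w, |P n w| ≤ C n)
    (hcongr : ∀ n w w', (∀ k ≤ n, w k = w' k) → P n w = P n w') :
    ∃ w : ℤ → ℝ, ∀ n, w n = u₀ + P n w := by
  have hC0 : ∀ n, 0 ≤ C n := fun n => (abs_nonneg _).trans (hC n 0)
  set K : Set (ℤ → ℝ) := Set.pi Set.univ fun n => Set.Icc (u₀ - C n) (u₀ + C n) with hK
  have hKc : IsCompact K := isCompact_univ_pi fun n => isCompact_Icc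
  -- solve finitely many equations
  have hfin : ∀ (a : ℤ) (m : ℕ), ∃ w ∈ K, ∀ n, a ≤ n → n < a + m → w n = u₀ + P n w := by
    intro a m
    induction m with
    | zero =>
      refine ⟨fun _ => u₀, ?_, fun n h1 h2 => by push_cast at h2; omega⟩
      intro n _
      have := hC0 n
      exact ⟨by linarith, by linarith⟩
    | succ m ih =>
      obtain ⟨w, hwK, hw⟩ := ih
      set N := a + (m : ℤ) with hN
      have hcont : Continuous fun x : ℝ => u₀ + P N (Function.update w N x) - x := by
        refine (continuous_const.add ((hc N).comp ?_)).sub continuous_id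
        exact continuous_const.update N continuous_id
      have h0 := hC0 N
      obtain ⟨x, hx, hx0⟩ := intermediate_value_Icc' (a := u₀ - C N) (b := u₀ + C N)
        (by linarith) hcont.continuousOn (show (0 : ℝ) ∈ Set.Icc _ _ from by
          have h1 := abs_le.1 (hC N (Function.update w N (u₀ - C N)))
          have h2 := abs_le.1 (hC N (Function.update w N (u₀ + C N)))
          exact ⟨by linarith, by linarith⟩)
      refine ⟨Function.update w N x, ?_, ?_⟩
      · intro n _
        rcases eq_or_ne n N with rfl | hn
        · simpa using hx
        · rw [Function.update_of_ne hn]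
          exact hwK n trivial
      · intro n h1 h2
        rcases eq_or_ne n N with rfl | hn
        · rw [Function.update_self]
          simp only at hx0
          linarith
        · have hlt : n < N := by push_cast at h2; omega
          rw [Function.update_of_ne hn, hw n h1 hlt]
          congr 1
          refine hcongr n _ _ fun k hk => ?_
          rw [Function.update_of_ne (by omega)]
  set A : ℕ → Set (ℤ → ℝ) := fun m => K ∩ {w | ∀ n, -(m : ℤ) ≤ n → n ≤ m → w n = u₀ + P n w} with hA
  have hcl : ∀ m, IsClosed (A m) := by
    intro m
    refine hKc.isClosed.inter ?_
    have : {w : ℤ → ℝ | ∀ n, -(m : ℤ) ≤ n → n ≤ m → w n = u₀ + P n w} =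
        ⋂ n : ℤ, ⋂ (_ : -(m : ℤ) ≤ n), ⋂ (_ : n ≤ m), {w | w n = u₀ + P n w} := by
      ext w; simp
    rw [this]
    exact isClosed_iInter fun n => isClosed_iInter fun _ => isClosed_iInter fun _ =>
      isClosed_eq (continuous_apply n) (continuous_const.add (hc n))
  obtain ⟨w, hw⟩ := IsCompact.nonempty_iInter_of_sequence_nonempty_isCompact_isClosed A
    (by
      intro m w hw
      refine ⟨hw.1, fun n h1 h2 => hw.2 n ?_ ?_⟩ <;> push_cast <;> omega)
    (by
      intro m
      obtain ⟨w, hwK, hw⟩ := hfin (-(m : ℤ)) (2 * m + 1)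
      exact ⟨w, hwK, fun n h1 h2 => hw n h1 (by push_cast; omega)⟩)
    (hKc.of_isClosed_subset (hcl 0) Set.inter_subset_left) hcl
  refine ⟨w, fun n => ?_⟩
  exact ((Set.mem_iInter.1 hw n.natAbs).2 n (by omega) (by omega))

end Aux


/-- global existence of a mild solution under the strengthened Lipschitz
condition `0 < F_ℓ < p^{-αℓ}`. -/
theorem global_mild_solution_exists (p : ℕ) [Fact p.Prime] (α γ : ℝ)
    (hα : 0 < α) (hγ0 : 0 < γ) (hγ : γ < min 1 α) (u₀ M F : ℝ) (f : ℤ → ℝ → ℝ)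
    (hM : ∀ (ℓ : ℤ) (x : ℝ), |f ℓ x| ≤ M)
    (hF : ∀ (ℓ : ℤ) (x y : ℝ), |f ℓ x - f ℓ y| ≤ F * |x - y|)
    (Fl : ℤ → ℝ) (hFl0 : ∀ ℓ : ℤ, 0 < Fl ℓ) (hFl1 : ∀ ℓ : ℤ, Fl ℓ < (p : ℝ) ^ (-α * (ℓ : ℝ)))
    (hFlip : ∀ (ℓ : ℤ) (x y : ℝ), |f ℓ x - f ℓ y| ≤ Fl ℓ * |x - y|) :
    ∃ u : ℚ_[p] → ℝ, Radial p u ∧ u 0 = u₀ ∧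
      ∀ t : ℚ_[p], t ≠ 0 →
        IntegrableOn (fun y => Iker p α t y * (‖y‖ ^ (-γ) * f (-y.valuation) (u y)))
          {y : ℚ_[p] | ‖y‖ ≤ ‖t‖} (padicHaar p) ∧
        u t = u₀ + Iop p α (fun y => ‖y‖ ^ (-γ) * f (-y.valuation) (u y)) t := by
  have hγ1 : γ < 1 := hγ.trans_le (min_le_left _ _)
  have hγα : γ < α := hγ.trans_le (min_le_right _ _)
  have hp := one_lt_p p
  have hfc : ∀ ℓ, Continuous (f ℓ) := fun ℓ =>
    (LipschitzWith.of_dist_le_mul (K := ⟨Fl ℓ, (hFl0 ℓ).le⟩) fun x y => by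
      rw [Real.dist_eq, Real.dist_eq]; exact hFlip ℓ x y).continuous
  choose C hC using fun n : ℤ => Iop_bound p α γ M hα hγ1 hγα f hM (sph p n) (sph_ne_zero p n)
  obtain ⟨w, hw⟩ := exists_sequence u₀ (fun n w => Iop p α (Vf p γ f w) (sph p n))
    (fun n => continuous_Iop p α γ M hα hγ1 hγα f hM hfc _ (sph_ne_zero p n)) C hC
    (fun n w w' h => Iop_congr p α γ hγ0 f n w w' h)
  classical
  set u : ℚ_[p] → ℝ := fun y => if y = 0 then u₀ else w (-y.valuation) with hu
  have hV : (fun y : ℚ_[p] => ‖y‖ ^ (-γ) * f (-y.valuation) (u y)) = Vf p γ f w := by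
    funext y
    unfold Vf
    rcases eq_or_ne y 0 with rfl | hy
    · rw [norm_zero, Real.zero_rpow (by linarith)]; simp
    · simp only [hu, if_neg hy]
  refine ⟨u, ?_, by simp [hu], ?_⟩
  · intro x y hxy
    rcases eq_or_ne x 0 with rfl | hx
    · have : y = 0 := by rw [← norm_eq_zero, ← hxy, norm_zero]
      rw [this]
    · have hy : y ≠ 0 := by rw [← norm_pos_iff, ← hxy]; exact norm_pos_iff.2 hx
      rw [Padic.norm_eq_zpow_neg_valuation hx, Padic.norm_eq_zpow_neg_valuation hy,
        zpow_right_inj₀ (by linarith) hp.ne'] at hxy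
      simp only [hu, if_neg hx, if_neg hy, hxy]
  · intro t ht
    rw [hV]
    refine ⟨?_, ?_⟩
    · have h := integrable_Vf p α γ M hα hγ1 hγα f hM w t ht
      rw [← hV] at h
      exact h
    · have hn : ‖t‖ = ‖sph p (-t.valuation)‖ := by
        rw [norm_sph, Padic.norm_eq_zpow_neg_valuation ht]
      rw [Iop_radial p α _ (radial_Vf p γ hγ0 f w) t _ (sph_ne_zero p _) hn]
      simp only [hu, if_neg ht]
      exact hw _
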